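/- arXiv:math/0105023 — 2 statements merged into one kernel-verified Lean document; each statement's English description precedes it below -/
import Mathlib

section
/- Every 2-dimensional unital commutative associative real algebra is isomorphic to exactly one of: R × R (with product (a,b)(c,d) = (ac,bd)), the dual numbers R[t]/(t²), or the complex numbers C. -/
open Module in
/-- In a two-dimensional algebra over a field, `1` and any non-scalar element span. -/
theorem exists_eq_algebraMap_add_smul {K A : Type*} [Field K] [CommRing A] [Algebra K A]
    (hdim : finrank K A = 2) {x : A} (hx : x ∉ Set.range (algebraMap K A)) (z : A) :
    ∃ p q : K, z = algebraMap K A p + q • x := by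
  have : Nontrivial A := nontrivial_of_finrank_pos (R := K) (by omega)
  have hli : LinearIndependent K ![(1 : A), x] := by
    rw [LinearIndependent.pair_iff' one_ne_zero]
    intro a ha
    exact hx ⟨a, by rw [Algebra.algebraMap_eq_smul_one, ha]⟩
  have hspan := hli.span_eq_top_of_card_eq_finrank (by simp [hdim])
  have hz : z ∈ Submodule.span K (Set.range ![(1 : A), x]) := hspan ▸ Submodule.mem_top
  rw [Matrix.range_cons_cons_empty, Submodule.mem_span_pair] at hz
  obtain ⟨p, q, h⟩ := hz
  exact ⟨p, q, by rw [Algebra.algebraMap_eq_smul_one, h]⟩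

open Module in
/-- A two-dimensional algebra containing a non-scalar square root of the scalar `d` is the
quadratic algebra `K[ω]/(ω² - d)`. -/
theorem QuadraticAlgebra.nonempty_algEquiv_of_mul_self_eq {K A : Type*} [Field K] [CommRing A]
    [Algebra K A] (hdim : finrank K A = 2) {x : A} (hx : x ∉ Set.range (algebraMap K A))
    {d : K} (hd : x * x = algebraMap K A d) :
    Nonempty (QuadraticAlgebra K d 0 ≃ₐ[K] A) := by
  have : FiniteDimensional K A := FiniteDimensional.of_finrank_pos (by omega)
  let f : QuadraticAlgebra K d 0 →ₐ[K] A :=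
    QuadraticAlgebra.lift ⟨x, by simp [hd, Algebra.algebraMap_eq_smul_one]⟩
  have hf : Function.Surjective f := by
    intro z
    obtain ⟨p, q, rfl⟩ := exists_eq_algebraMap_add_smul hdim hx z
    exact ⟨⟨p, q⟩, by simp [f, Algebra.algebraMap_eq_smul_one]⟩
  have hinj : Function.Injective f :=
    (LinearMap.injective_iff_surjective_of_finrank_eq_finrank (f := f.toLinearMap)
      (by rw [hdim, QuadraticAlgebra.finrank_eq_two])).2 hf
  exact ⟨AlgEquiv.ofBijective f ⟨hinj, hf⟩⟩

open Module in
theorem nonempty_algEquiv_of_mul_self_eq {K A B : Type*} [Field K] [CommRing A] [Algebra K A]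
    [CommRing B] [Algebra K B] (hA : finrank K A = 2) (hB : finrank K B = 2) {d : K}
    {x : A} (hx : x ∉ Set.range (algebraMap K A)) (hxd : x * x = algebraMap K A d)
    {y : B} (hy : y ∉ Set.range (algebraMap K B)) (hyd : y * y = algebraMap K B d) :
    Nonempty (A ≃ₐ[K] B) := by
  obtain ⟨e⟩ := QuadraticAlgebra.nonempty_algEquiv_of_mul_self_eq hA hx hxd
  obtain ⟨g⟩ := QuadraticAlgebra.nonempty_algEquiv_of_mul_self_eq hB hy hyd
  exact ⟨e.symm.trans g⟩

open Module in
/-- Completing the square in a two-dimensional algebra. -/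
theorem exists_mul_self_eq_algebraMap {K A : Type*} [Field K] [NeZero (2 : K)] [CommRing A]
    [Algebra K A] (hdim : finrank K A = 2) :
    ∃ y : A, y ∉ Set.range (algebraMap K A) ∧ ∃ d : K, y * y = algebraMap K A d := by
  obtain ⟨x, hx⟩ : ∃ x : A, x ∉ Set.range (algebraMap K A) := by
    by_contra! h
    have := finrank_le_one (R := K) (1 : A) fun w ↦ by
      obtain ⟨c, hc⟩ := h w
      exact ⟨c, by rw [← hc, Algebra.algebraMap_eq_smul_one]⟩
    omega
  obtain ⟨p, q, h⟩ := exists_eq_algebraMap_add_smul hdim hx (x * x)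
  refine ⟨x - algebraMap K A (q / 2), ?_, p + (q / 2) * (q / 2), ?_⟩
  · rintro ⟨c, hc⟩
    exact hx ⟨c + q / 2, by rw [map_add, hc, sub_add_cancel]⟩
  · have hq : algebraMap K A q = algebraMap K A (q / 2) + algebraMap K A (q / 2) := by
      rw [← map_add, add_halves]
    rw [Algebra.smul_def, hq] at h
    rw [map_add, map_mul]
    linear_combination h

open Module in
/-- In a two-dimensional real algebra, the square of a suitable non-scalar element is
`1`, `0` or `-1`. -/
theorem exists_mul_self_eq_algebraMap_sign {A : Type*} [CommRing A] [Algebra ℝ A]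
    (hdim : finrank ℝ A = 2) :
    ∃ y : A, y ∉ Set.range (algebraMap ℝ A) ∧
      ∃ d : ℝ, y * y = algebraMap ℝ A d ∧ (d = 1 ∨ d = 0 ∨ d = -1) := by
  obtain ⟨y, hy, d, hd⟩ := exists_mul_self_eq_algebraMap hdim
  rcases eq_or_ne d 0 with rfl | hd0
  · exact ⟨y, hy, 0, hd, by simp⟩
  have hs : √|d| ≠ 0 := by positivity
  have hss : √|d| * √|d| = |d| := Real.mul_self_sqrt (abs_nonneg d)
  refine ⟨(√|d|)⁻¹ • y, ?_, |d|⁻¹ * d, ?_, ?_⟩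
  · rintro ⟨c, hc⟩
    refine hy ⟨√|d| * c, ?_⟩
    rw [map_mul, hc, ← Algebra.smul_def, smul_inv_smul₀ hs]
  · rw [smul_mul_smul_comm, hd, ← mul_inv, hss, map_mul, Algebra.smul_def]
  · rcases abs_cases d with ⟨h, -⟩ | ⟨h, -⟩
    · left; rw [h, inv_mul_cancel₀ hd0]
    · right; right; rw [h, inv_neg, neg_mul, inv_mul_cancel₀ hd0]

/-- Every 2-dimensional unital commutative associative real algebra is
isomorphic to exactly one of `ℝ × ℝ`, the dual numbers `ℝ[t]/(t²)`, or `ℂ`. -/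
theorem stmt_3 (A : Type*) [CommRing A] [Algebra ℝ A]
    (hdim : Module.finrank ℝ A = 2) :
    (Nonempty (A ≃ₐ[ℝ] (ℝ × ℝ)) ∨ Nonempty (A ≃ₐ[ℝ] DualNumber ℝ) ∨
      Nonempty (A ≃ₐ[ℝ] ℂ)) ∧
    IsEmpty ((ℝ × ℝ) ≃ₐ[ℝ] DualNumber ℝ) ∧
    IsEmpty ((ℝ × ℝ) ≃ₐ[ℝ] ℂ) ∧
    IsEmpty (DualNumber ℝ ≃ₐ[ℝ] ℂ) := by
  refine ⟨?_, ⟨fun e ↦ ?_⟩, ⟨fun e ↦ ?_⟩, ⟨fun e ↦ ?_⟩⟩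
  · obtain ⟨y, hy, d, hd, rfl | rfl | rfl⟩ := exists_mul_self_eq_algebraMap_sign hdim
    · refine .inl (nonempty_algEquiv_of_mul_self_eq hdim (by simp) hy hd
        (y := ((1, -1) : ℝ × ℝ)) ?_ (by simp))
      rintro ⟨c, hc⟩
      simp only [Prod.algebraMap_apply, Algebra.algebraMap_self_apply, Prod.mk.injEq] at hc
      linarith [hc.1, hc.2]
    · have hfin : Module.finrank ℝ (DualNumber ℝ) = 2 := by
        change Module.finrank ℝ (ℝ × ℝ) = 2
        simp
      refine .inr (.inl (nonempty_algEquiv_of_mul_self_eq hdim hfin hy hd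
        (y := DualNumber.eps) ?_ (by simp)))
      rintro ⟨c, hc⟩
      simpa [TrivSqZeroExt.algebraMap_eq_inl] using congrArg TrivSqZeroExt.snd hc
    · refine .inr (.inr (nonempty_algEquiv_of_mul_self_eq hdim Complex.finrank_real_complex hy hd
        (y := Complex.I) ?_ (by simp)))
      rintro ⟨c, hc⟩
      simpa using congrArg Complex.im hc
  · have h : e.symm DualNumber.eps * e.symm DualNumber.eps = 0 := by
      rw [← map_mul, DualNumber.eps_mul_eps, map_zero]
    have h0 : e.symm DualNumber.eps = 0 := IsNilpotent.eq_zero ⟨2, by rw [sq, h]⟩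
    simpa using congrArg TrivSqZeroExt.snd ((map_eq_zero_iff _ e.symm.injective).1 h0)
  · have h : e (1, 0) * e (0, 1) = 0 := by simp [← map_mul]
    rcases mul_eq_zero.1 h with h | h <;> simp at h
  · have h : e DualNumber.eps * e DualNumber.eps = 0 := by
      rw [← map_mul, DualNumber.eps_mul_eps, map_zero]
    have h0 := (map_eq_zero_iff _ e.injective).1 (mul_self_eq_zero.1 h)
    simpa using congrArg TrivSqZeroExt.snd h0
end

section
/- Every 3-dimensional nilpotent commutative associative real algebra is isomorphic to exactly one of the following five algebras (given by the nonzero products on a basis e₁,e₂,e₃): (i) e₁²=e₂, e₃²=e₂; (ii) e₁²=e₂, e₃²=−e₂; (iii) e₁²=e₂; (iv) e₁²=e₂, e₁e₂=e₂e₁=e₃; (v) the zero algebra. -/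
/-- The five model products on `ℝ³` (basis `e₁ = 0, e₂ = 1, e₃ = 2`):
(i) `e₁² = e₂, e₃² = e₂`; (ii) `e₁² = e₂, e₃² = -e₂`; (iii) `e₁² = e₂`;
(iv) `e₁² = e₂, e₁e₂ = e₂e₁ = e₃`; (v) the zero algebra. -/
def nilModels : Fin 5 → (Fin 3 → ℝ) → (Fin 3 → ℝ) → (Fin 3 → ℝ) :=
  ![fun x y => ![0, x 0 * y 0 + x 2 * y 2, 0],
    fun x y => ![0, x 0 * y 0 - x 2 * y 2, 0],
    fun x y => ![0, x 0 * y 0, 0],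
    fun x y => ![0, x 0 * y 0, x 0 * y 1 + x 1 * y 0],
    fun _ _ => 0]

section Invariants

variable {V W : Type*} [Zero V] [Zero W]

/-- Some product is nonzero. -/
def HasNonzeroProduct (p : V → V → V) : Prop := ∃ x y, p x y ≠ 0

/-- Some threefold product is nonzero. -/
def HasNonzeroTripleProduct (p : V → V → V) : Prop := ∃ x y z, p (p x y) z ≠ 0

/-- Some element of square zero does not annihilate everything. -/
def HasIsotropicNonAnnihilator (p : V → V → V) : Prop := ∃ x y, p x x = 0 ∧ p x y ≠ 0

/-- Some element of square zero is not a product. -/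
def HasIsotropicNonProduct (p : V → V → V) : Prop := ∃ x, p x x = 0 ∧ ∀ y z, p y z ≠ x

/-- The properties above are invariant under isomorphism. -/
theorem invariants_congr {p : V → V → V} {q : W → W → W} (e : V ≃ W) (e0 : e 0 = 0)
    (h : ∀ x y, e (p x y) = q (e x) (e y)) :
    (HasNonzeroProduct p ↔ HasNonzeroProduct q) ∧
    (HasNonzeroTripleProduct p ↔ HasNonzeroTripleProduct q) ∧
    (HasIsotropicNonAnnihilator p ↔ HasIsotropicNonAnnihilator q) ∧
    (HasIsotropicNonProduct p ↔ HasIsotropicNonProduct q) := by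
  have hz : ∀ x, e x = 0 ↔ x = 0 := fun x => by rw [← e0, e.apply_eq_iff_eq]
  simp only [HasNonzeroProduct, HasNonzeroTripleProduct, HasIsotropicNonAnnihilator,
    HasIsotropicNonProduct, e.surjective.exists, e.surjective.forall, ← h, hz, ne_eq,
    e.apply_eq_iff_eq, and_self]

end Invariants

theorem hasNonzeroProduct_nilModels (i : Fin 5) :
    HasNonzeroProduct (nilModels i) ↔ i ≠ 4 := by
  unfold HasNonzeroProduct
  fin_cases i
  iterate 4
    refine iff_of_true ⟨![1, 0, 0], ![1, 0, 0], fun h => ?_⟩ (by decide)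
    simpa [nilModels] using congrFun h 1
  exact iff_of_false (by simp [nilModels]) (by decide)

theorem hasNonzeroTripleProduct_nilModels (i : Fin 5) :
    HasNonzeroTripleProduct (nilModels i) ↔ i = 3 := by
  unfold HasNonzeroTripleProduct
  fin_cases i
  iterate 3
    refine iff_of_false ?_ (by decide)
    rintro ⟨x, y, z, h⟩
    apply h
    ext j
    fin_cases j <;> simp [nilModels]
  · refine iff_of_true ⟨![1, 0, 0], ![1, 0, 0], ![1, 0, 0], fun h => ?_⟩ (by decide)
    simpa [nilModels] using congrFun h 2
  · exact iff_of_false (by simp [nilModels]) (by decide)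

theorem hasIsotropicNonAnnihilator_nilModels_one :
    HasIsotropicNonAnnihilator (nilModels 1) := by
  refine ⟨![1, 0, 1], ![1, 0, 0], ?_, fun h => ?_⟩
  · ext j
    fin_cases j <;> simp [nilModels]
  · simpa [nilModels] using congrFun h 1

theorem not_hasIsotropicNonAnnihilator_nilModels_zero :
    ¬ HasIsotropicNonAnnihilator (nilModels 0) := by
  rintro ⟨x, y, h, h'⟩
  have h1 : x 0 * x 0 + x 2 * x 2 = 0 := by simpa [nilModels] using congrFun h 1
  obtain ⟨h0, h2⟩ := (mul_self_add_mul_self_eq_zero).1 h1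
  apply h'
  ext j
  fin_cases j <;> simp [nilModels, h0, h2]

theorem not_hasIsotropicNonAnnihilator_nilModels_two :
    ¬ HasIsotropicNonAnnihilator (nilModels 2) := by
  rintro ⟨x, y, h, h'⟩
  have h0 : x 0 = 0 := by simpa [nilModels] using congrFun h 1
  apply h'
  ext j
  fin_cases j <;> simp [nilModels, h0]

theorem not_hasIsotropicNonProduct_nilModels_zero :
    ¬ HasIsotropicNonProduct (nilModels 0) := by
  rintro ⟨x, h, h'⟩
  have h1 : x 0 * x 0 + x 2 * x 2 = 0 := by simpa [nilModels] using congrFun h 1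
  obtain ⟨h0, h2⟩ := (mul_self_add_mul_self_eq_zero).1 h1
  apply h' ![1, 0, 0] ![x 1, 0, 0]
  ext j
  fin_cases j <;> simp [nilModels, h0, h2]

theorem hasIsotropicNonProduct_nilModels_two :
    HasIsotropicNonProduct (nilModels 2) := by
  refine ⟨![0, 0, 1], ?_, fun y z h => ?_⟩
  · ext j
    fin_cases j <;> simp [nilModels]
  · simpa [nilModels] using congrFun h 2

/-- The model algebras are pairwise non-isomorphic. -/
theorem nilModels_index_unique {i j : Fin 5}
    (h1 : HasNonzeroProduct (nilModels i) ↔ HasNonzeroProduct (nilModels j))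
    (h2 : HasNonzeroTripleProduct (nilModels i) ↔ HasNonzeroTripleProduct (nilModels j))
    (h3 : HasIsotropicNonAnnihilator (nilModels i) ↔ HasIsotropicNonAnnihilator (nilModels j))
    (h4 : HasIsotropicNonProduct (nilModels i) ↔ HasIsotropicNonProduct (nilModels j)) :
    i = j := by
  have a0 := not_hasIsotropicNonAnnihilator_nilModels_zero
  have a1 := hasIsotropicNonAnnihilator_nilModels_one
  have a2 := not_hasIsotropicNonAnnihilator_nilModels_two
  have b0 := not_hasIsotropicNonProduct_nilModels_zero
  have b2 := hasIsotropicNonProduct_nilModels_two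
  rw [hasNonzeroProduct_nilModels, hasNonzeroProduct_nilModels] at h1
  rw [hasNonzeroTripleProduct_nilModels, hasNonzeroTripleProduct_nilModels] at h2
  fin_cases i <;> fin_cases j <;> simp_all

section Existence

variable {A : Type*} [AddCommGroup A] [Module ℝ A]

/-- Three linearly independent vectors of a three-dimensional space form a basis. -/
theorem exists_basis_of_independent (hdim : Module.finrank ℝ A = 3) {u v w : A}
    (h : ∀ a b c : ℝ, a • u + b • v + c • w = 0 → a = 0 ∧ b = 0 ∧ c = 0) :
    ∃ b : Module.Basis (Fin 3) ℝ A, b 0 = u ∧ b 1 = v ∧ b 2 = w := by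
  have hli : LinearIndependent ℝ ![u, v, w] := by
    rw [Fintype.linearIndependent_iff]
    intro g hg
    obtain ⟨h0, h1, h2⟩ := h (g 0) (g 1) (g 2) (by simpa [Fin.sum_univ_three] using hg)
    intro i
    fin_cases i <;> assumption
  refine ⟨basisOfLinearIndependentOfCardEqFinrank hli (by simp [hdim]), ?_, ?_, ?_⟩ <;> simp

/-- If `u` has nonzero square annihilated by `u`, then `u`, its square and any vector outside of
their span are linearly independent. -/
theorem independent_of_notMem_span {mul : A →ₗ[ℝ] A →ₗ[ℝ] A} {u w : A} (hu : mul u u ≠ 0)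
    (huu : mul u (mul u u) = 0) (hw : w ∉ Submodule.span ℝ {u, mul u u}) (a b c : ℝ)
    (h : a • u + b • mul u u + c • w = 0) : a = 0 ∧ b = 0 ∧ c = 0 := by
  have hc : c = 0 := by
    by_contra hc
    apply hw
    rw [Submodule.mem_span_pair]
    refine ⟨-(c⁻¹ * a), -(c⁻¹ * b), ?_⟩
    have h' := congrArg (fun t => c⁻¹ • t) h
    simp only [smul_add, smul_smul, inv_mul_cancel₀ hc, one_smul, smul_zero] at h'
    rw [← sub_eq_zero, ← neg_eq_zero, ← h']
    module
  subst hc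
  have ha : a = 0 := by simpa [huu, hu] using congrArg (mul u) h
  subst ha
  exact ⟨rfl, by simpa [hu] using h, rfl⟩

/-- A basis with the multiplication table of a model gives an isomorphism with it. -/
theorem exists_equiv_of_basis {mul : A →ₗ[ℝ] A →ₗ[ℝ] A} (b : Module.Basis (Fin 3) ℝ A)
    (k : Fin 5)
    (h : ∀ x y : Fin 3 → ℝ,
      mul (x 0 • b 0 + x 1 • b 1 + x 2 • b 2) (y 0 • b 0 + y 1 • b 1 + y 2 • b 2) =
        nilModels k x y 0 • b 0 + nilModels k x y 1 • b 1 + nilModels k x y 2 • b 2) :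
    ∃ e : A ≃ₗ[ℝ] (Fin 3 → ℝ), ∀ X Y : A, e (mul X Y) = nilModels k (e X) (e Y) := by
  refine ⟨b.equivFun, fun X Y => ?_⟩
  rw [← LinearEquiv.eq_symm_apply, Module.Basis.equivFun_symm_apply, Fin.sum_univ_three, ← h,
    ← Fin.sum_univ_three (fun i => b.equivFun X i • b i),
    ← Fin.sum_univ_three (fun i => b.equivFun Y i • b i), b.sum_equivFun, b.sum_equivFun]

/-- An algebra with a basis `u, v, w` whose only nonzero products are `u² = v` and `w² = q v` is
isomorphic to one of the first three models if `q` is `1`, `-1` or `0`. -/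
theorem exists_equiv_of_diagonal (hdim : Module.finrank ℝ A = 3) {mul : A →ₗ[ℝ] A →ₗ[ℝ] A}
    (hcomm : ∀ X Y : A, mul X Y = mul Y X) {u w : A} (hu : mul u u ≠ 0)
    (hann : ∀ X, mul (mul u u) X = 0) (hw : w ∉ Submodule.span ℝ {u, mul u u})
    (huw : mul u w = 0) (q : ℝ) (hq : mul w w = q • mul u u) (k : Fin 5)
    (hk : ∀ x y, nilModels k x y = ![0, x 0 * y 0 + q * (x 2 * y 2), 0]) :
    ∃ e : A ≃ₗ[ℝ] (Fin 3 → ℝ), ∀ X Y : A, e (mul X Y) = nilModels k (e X) (e Y) := by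
  have hann' : ∀ X, mul X (mul u u) = 0 := fun X => by rw [hcomm, hann]
  obtain ⟨b, h0, h1, h2⟩ := exists_basis_of_independent hdim
    (independent_of_notMem_span hu (hann' u) hw)
  refine exists_equiv_of_basis b k fun x y => ?_
  rw [h0, h1, h2, hk]
  simp only [map_add, map_smul, LinearMap.add_apply, LinearMap.smul_apply, hann, hann', huw,
    hcomm w u, hq, Matrix.cons_val]
  module

/-- An algebra containing an element `u` with `u³ ≠ 0` and `u⁴ = 0` is isomorphic to the fourth
model. -/
theorem exists_equiv_of_cube_ne_zero (hdim : Module.finrank ℝ A = 3)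
    {mul : A →ₗ[ℝ] A →ₗ[ℝ] A}
    (hassoc : ∀ X Y Z : A, mul (mul X Y) Z = mul X (mul Y Z)) {u : A}
    (hu : mul u (mul u u) ≠ 0) (hu4 : mul u (mul u (mul u u)) = 0) :
    ∃ e : A ≃ₗ[ℝ] (Fin 3 → ℝ), ∀ X Y : A, e (mul X Y) = nilModels 3 (e X) (e Y) := by
  obtain ⟨b, h0, h1, h2⟩ := exists_basis_of_independent (u := u) (v := mul u u)
      (w := mul u (mul u u)) hdim (fun a b c h => by
    have ha : a = 0 := by simpa [hu4, hu] using congrArg (fun t => mul u (mul u t)) h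
    subst ha
    have hb : b = 0 := by simpa [hu4, hu] using congrArg (mul u) h
    subst hb
    exact ⟨rfl, rfl, by simpa [hu] using h⟩)
  refine exists_equiv_of_basis b 3 fun x y => ?_
  rw [h0, h1, h2]
  simp only [map_add, map_smul, LinearMap.add_apply, LinearMap.smul_apply, hassoc, hu4, map_zero,
    nilModels, Matrix.cons_val]
  module

/-- If all cubes vanish then all squares annihilate the algebra. -/
theorem mul_self_mul_eq_zero {mul : A →ₗ[ℝ] A →ₗ[ℝ] A}
    (hcomm : ∀ X Y : A, mul X Y = mul Y X)
    (hassoc : ∀ X Y Z : A, mul (mul X Y) Z = mul X (mul Y Z))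
    (hcube : ∀ X, mul X (mul X X) = 0) (X Y : A) : mul (mul X X) Y = 0 := by
  have hp := hcube (X + Y)
  have hm := hcube (X - Y)
  have h1 : mul Y (mul X X) = mul X (mul X Y) := by rw [hcomm, hassoc]
  have h2 : mul Y (mul X Y) = mul X (mul Y Y) := by rw [hcomm, hassoc]
  simp only [map_add, map_sub, LinearMap.add_apply, LinearMap.sub_apply, hcube, hcomm Y X, h1,
    h2] at hp hm
  rw [hassoc]
  have h6 : (6 : ℝ) • mul X (mul X Y) = 0 := by
    linear_combination (norm := module) hp - hm
  simpa using h6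

/-- A nonzero commutative product has a nonzero square. -/
theorem exists_mul_self_ne_zero {mul : A →ₗ[ℝ] A →ₗ[ℝ] A}
    (hcomm : ∀ X Y : A, mul X Y = mul Y X) {X Y : A} (h : mul X Y ≠ 0) :
    ∃ u, mul u u ≠ 0 := by
  by_contra! hsq
  have hp := hsq (X + Y)
  simp only [map_add, LinearMap.add_apply, hsq, hcomm Y X, zero_add, add_zero] at hp
  rw [← two_smul ℝ] at hp
  exact h (by simpa using hp)

/-- The algebras with vanishing cubes and nonzero product are among the first three models. -/
theorem exists_equiv_of_cube_eq_zero (hdim : Module.finrank ℝ A = 3)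
    {mul : A →ₗ[ℝ] A →ₗ[ℝ] A} (hcomm : ∀ X Y : A, mul X Y = mul Y X)
    (hassoc : ∀ X Y Z : A, mul (mul X Y) Z = mul X (mul Y Z))
    (hcube : ∀ X, mul X (mul X X) = 0) {u : A} (hu : mul u u ≠ 0) :
    ∃ (k : Fin 5) (e : A ≃ₗ[ℝ] (Fin 3 → ℝ)), ∀ X Y : A,
      e (mul X Y) = nilModels k (e X) (e Y) := by
  have hsq := mul_self_mul_eq_zero hcomm hassoc hcube
  have hsq' : ∀ X Y, mul X (mul Y Y) = 0 := fun X Y => by rw [hcomm, hsq]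
  obtain ⟨z, hz⟩ : ∃ z, z ∉ Submodule.span ℝ {u, mul u u} := by
    classical
    by_contra! hall
    have htop : Submodule.span ℝ {u, mul u u} = ⊤ := Submodule.eq_top_iff'.2 hall
    have hle := finrank_span_finset_le_card (R := ℝ) ({u, mul u u} : Finset A)
    rw [Set.finrank, Finset.coe_pair, htop, finrank_top, hdim] at hle
    have hc := Finset.card_le_two (a := u) (b := mul u u)
    omega
  have hexp : ∀ X : A, ∀ w ∉ Submodule.span ℝ {u, mul u u},
      ∃ a b c : ℝ, X = a • u + b • mul u u + c • w := by
    intro X w hw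
    obtain ⟨b, h0, h1, h2⟩ := exists_basis_of_independent hdim
      (independent_of_notMem_span hu (hcube u) hw)
    refine ⟨b.repr X 0, b.repr X 1, b.repr X 2, ?_⟩
    rw [← h1, ← h0, ← h2, ← Fin.sum_univ_three (fun i => b.repr X i • b i), b.sum_repr]
  obtain ⟨β, hβ⟩ : ∃ β : ℝ, mul u z = β • mul u u := by
    obtain ⟨a, b, c, h⟩ := hexp (mul u z) z hz
    have h' := congrArg (mul u) h
    rw [← hassoc, hsq] at h'
    simp only [map_add, map_smul, hcube, smul_zero, add_zero] at h'
    by_cases hc : c = 0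
    · have ha : a = 0 := by simpa [hc, hu] using h'.symm
      exact ⟨b, by rw [h, ha, hc]; module⟩
    · refine ⟨-(c⁻¹ * a), ?_⟩
      have h'' := congrArg (fun t => c⁻¹ • t) h'
      simp only [smul_add, smul_smul, inv_mul_cancel₀ hc, one_smul, smul_zero] at h''
      rw [neg_smul, eq_neg_iff_add_eq_zero, add_comm, ← h'']
  have humem : u ∈ Submodule.span ℝ {u, mul u u} := Submodule.subset_span (by simp)
  obtain ⟨w, hw, huw⟩ : ∃ w ∉ Submodule.span ℝ {u, mul u u}, mul u w = 0 := by
    refine ⟨z - β • u, fun h => hz ?_, by simp [hβ]⟩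
    simpa using Submodule.add_mem _ h (Submodule.smul_mem _ β humem)
  obtain ⟨q, hq⟩ : ∃ q : ℝ, mul w w = q • mul u u := by
    obtain ⟨a, b, c, h⟩ := hexp (mul w w) w hw
    have ha : a = 0 := by
      have h' := congrArg (mul u) h
      simpa [hsq', huw, hu] using h'.symm
    have h' := congrArg (mul w) h
    simp only [map_add, map_smul, hsq', hcomm w u, huw, smul_zero, add_zero, zero_add] at h'
    rcases smul_eq_zero.1 h'.symm with hc | hc
    · exact ⟨b, by rw [h, ha, hc]; module⟩
    · exact ⟨0, by simp [hc]⟩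
  have hscale : ∀ s : ℝ, s ≠ 0 → ∀ (r : ℝ) (k : Fin 5), s * s * q = r →
      (∀ x y, nilModels k x y = ![0, x 0 * y 0 + r * (x 2 * y 2), 0]) →
      ∃ e : A ≃ₗ[ℝ] (Fin 3 → ℝ), ∀ X Y : A, e (mul X Y) = nilModels k (e X) (e Y) := by
    intro s hs r k hr hk
    refine exists_equiv_of_diagonal hdim hcomm hu (hsq u) (w := s • w) ?_ (by simp [huw]) r ?_ k hk
    · rwa [Submodule.smul_mem_iff _ hs]
    · simp [hq, smul_smul, ← hr, mul_assoc]
  rcases lt_trichotomy q 0 with hneg | hzero | hpos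
  · have hpos : 0 < √(-q) := Real.sqrt_pos.2 (by linarith)
    have hsqrt : √(-q) * √(-q) = -q := Real.mul_self_sqrt (by linarith)
    refine ⟨1, hscale (√(-q))⁻¹ (by positivity) (-1) 1 ?_ fun x y => ?_⟩
    · rw [← mul_inv, hsqrt]
      field_simp [hneg.ne]
    · simp [nilModels, sub_eq_add_neg]
  · exact ⟨2, hscale 1 one_ne_zero 0 2 (by simp [hzero]) fun x y => by simp [nilModels]⟩
  · have hpos' : 0 < √q := Real.sqrt_pos.2 hpos
    have hsqrt : √q * √q = q := Real.mul_self_sqrt hpos.le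
    refine ⟨0, hscale (√q)⁻¹ (by positivity) 1 0 ?_ fun x y => ?_⟩
    · rw [← mul_inv, hsqrt]
      field_simp
    · simp [nilModels]

/-- In a nilpotent algebra of dimension three, fourth powers vanish. -/
theorem fourth_power_eq_zero (hdim : Module.finrank ℝ A = 3) {mul : A →ₗ[ℝ] A →ₗ[ℝ] A}
    (hcomm : ∀ X Y : A, mul X Y = mul Y X)
    (hnil : ∃ n : ℕ, 1 ≤ n ∧ ∀ (x : A) (l : List A), l.length = n - 1 →
      l.foldl (fun acc b => mul acc b) x = 0) (u : A) :
    mul u (mul u (mul u u)) = 0 := by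
  have : Module.Finite ℝ A := Module.finite_of_finrank_pos (by omega)
  obtain ⟨n, -, hn⟩ := hnil
  have hfold : ∀ (m : ℕ) (x : A),
      (List.replicate m u).foldl (fun acc b => mul acc b) x = (mul u ^ m) x := by
    intro m
    induction m with
    | zero => simp
    | succ m ih => intro x; rw [List.replicate_succ, List.foldl_cons, ih, hcomm, pow_succ]; rfl
  have hpow : mul u ^ (n - 1) = 0 := by
    ext x
    rw [← hfold, hn x _ (by simp)]
    rfl
  have h3 : mul u ^ 3 = 0 := by
    have := Module.End.ker_pow_le_ker_pow_finrank (mul u) (n - 1)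
    rw [hpow, hdim, LinearMap.ker_zero, top_le_iff, LinearMap.ker_eq_top] at this
    exact this
  simpa [pow_succ] using congrArg (fun f => f u) h3

end Existence

/-- Every 3-dimensional nilpotent commutative associative real algebra is
isomorphic to exactly one of the five model algebras. -/
theorem stmt_12 (A : Type*) [AddCommGroup A] [Module ℝ A]
    (hdim : Module.finrank ℝ A = 3)
    (mul : A →ₗ[ℝ] A →ₗ[ℝ] A)
    (hcomm : ∀ X Y : A, mul X Y = mul Y X)
    (hassoc : ∀ X Y Z : A, mul (mul X Y) Z = mul X (mul Y Z))
    (hnil : ∃ n : ℕ, 1 ≤ n ∧ ∀ (x : A) (l : List A), l.length = n - 1 →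
      l.foldl (fun acc b => mul acc b) x = 0) :
    ∃! i : Fin 5, ∃ e : A ≃ₗ[ℝ] (Fin 3 → ℝ), ∀ X Y : A,
      e (mul X Y) = nilModels i (e X) (e Y) := by
  refine existsUnique_of_exists_of_unique ?_ ?_
  · by_cases hzero : ∀ X Y, mul X Y = 0
    · have : Module.Finite ℝ A := Module.finite_of_finrank_pos (by omega)
      exact ⟨4, LinearEquiv.ofFinrankEq A (Fin 3 → ℝ) (by simp [hdim]), fun X Y => by
        simp [hzero, nilModels]⟩
    push Not at hzero
    obtain ⟨X, Y, hXY⟩ := hzero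
    by_cases hcube : ∀ X, mul X (mul X X) = 0
    · obtain ⟨u, hu⟩ := exists_mul_self_ne_zero hcomm hXY
      exact exists_equiv_of_cube_eq_zero hdim hcomm hassoc hcube hu
    · push Not at hcube
      obtain ⟨u, hu⟩ := hcube
      exact ⟨3, exists_equiv_of_cube_ne_zero hdim hassoc hu
        (fourth_power_eq_zero hdim hcomm hnil u)⟩
  · rintro i j ⟨e, he⟩ ⟨f, hf⟩
    obtain ⟨a1, a2, a3, a4⟩ := invariants_congr e.toEquiv (map_zero e) he
    obtain ⟨b1, b2, b3, b4⟩ := invariants_congr f.toEquiv (map_zero f) hf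
    exact nilModels_index_unique (a1.symm.trans b1) (a2.symm.trans b2) (a3.symm.trans b3)
      (a4.symm.trans b4)
end
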